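/- arXiv:2602.19525 — 2 statements merged into one kernel-verified Lean document; each statement's English description precedes it below -/
import Mathlib

section
/- The pentomino Y, consisting of the cells {(0,0),(0,1),(0,2),(0,3),(1,1)} in ℤ², is always-coverable. -/
/-- Two cells of `ℤ²` are edge-adjacent if they differ by `(±1,0)` or `(0,±1)`. -/
def Adjacent (a b : ℤ × ℤ) : Prop :=
  (a.1 - b.1).natAbs + (a.2 - b.2).natAbs = 1

/-- A polyomino is a nonempty finite subset of `ℤ²` that is connected
with respect to edge-adjacency. -/
def IsPolyomino (P : Set (ℤ × ℤ)) : Prop :=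
  P.Nonempty ∧ P.Finite ∧
    ∀ a ∈ P, ∀ b ∈ P,
      Relation.ReflTransGen (fun x y => x ∈ P ∧ y ∈ P ∧ Adjacent x y) a b

/-- An isometry of `ℤ²`: a composition of a translation with one of the eight
elements of the dihedral group (rotations by multiples of 90 degrees and
reflections) preserving the lattice. -/
def IsLatticeIsometry (f : ℤ × ℤ → ℤ × ℤ) : Prop :=
  ∃ (t : ℤ × ℤ) (e₁ e₂ : ℤ) (s : Bool),
    (e₁ = 1 ∨ e₁ = -1) ∧ (e₂ = 1 ∨ e₂ = -1) ∧
    ∀ p : ℤ × ℤ,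
      f p = if s then (t.1 + e₁ * p.2, t.2 + e₂ * p.1)
            else (t.1 + e₁ * p.1, t.2 + e₂ * p.2)

/-- `P'` is a congruent copy of `P` if it is the image of `P` under an
isometry of `ℤ²`. -/
def CongruentCopy (P' P : Set (ℤ × ℤ)) : Prop :=
  ∃ f : ℤ × ℤ → ℤ × ℤ, IsLatticeIsometry f ∧ P' = f '' P

/-- A polyomino `Q` is always-coverable if there exists `N` such that every
polyomino `P` with at least `N` cells admits two non-overlapping congruent
copies whose union contains a congruent copy of `Q`. -/
def AlwaysCoverable (Q : Set (ℤ × ℤ)) : Prop :=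
  ∃ N : ℕ, ∀ P : Set (ℤ × ℤ), IsPolyomino P → N ≤ P.ncard →
    ∃ P₁ P₂ : Set (ℤ × ℤ), CongruentCopy P₁ P ∧ CongruentCopy P₂ P ∧
      Disjoint P₁ P₂ ∧ ∃ Q' : Set (ℤ × ℤ), CongruentCopy Q' Q ∧ Q' ⊆ P₁ ∪ P₂

namespace YCover

/-- Explicit form of the winning condition: the second copy is the reflection
`(x, y) ↦ (u - y, v - x)` of the first one. -/
def Win (P : ℤ → ℤ → Prop) : Prop :=
  ∃ u v : ℤ, (∀ x y, P x y → ¬ P (u - y) (v - x)) ∧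
    ∃ (t₁ t₂ e₁ e₂ : ℤ) (s : Bool), (e₁ = 1 ∨ e₁ = -1) ∧ (e₂ = 1 ∨ e₂ = -1) ∧
      ∀ i j : ℤ, (i = 0 ∧ j = 0) ∨ (i = 0 ∧ j = 1) ∨ (i = 0 ∧ j = 2) ∨ (i = 0 ∧ j = 3) ∨
        (i = 1 ∧ j = 1) →
        ∃ x y : ℤ, ((x, y) = if s then (t₁ + e₁ * j, t₂ + e₂ * i)
            else (t₁ + e₁ * i, t₂ + e₂ * j)) ∧ (P x y ∨ P (v - y) (u - x))

theorem tp {P : ℤ → ℤ → Prop} {x y x' y' : ℤ} (h : P x y) (h1 : x' = x) (h2 : y' = y) :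
    P x' y' := by subst h1; subst h2; exact h

/-- vertical bar with cells `(t₁, t₂ + e₂ j)`, bump `(t₁ + e₁, t₂ + e₂)`. -/
theorem win_v {P : ℤ → ℤ → Prop} (u v : ℤ) (hd : ∀ x y, P x y → ¬ P (u - y) (v - x))
    (t₁ t₂ e₁ e₂ : ℤ) (h₁ : e₁ = 1 ∨ e₁ = -1) (h₂ : e₂ = 1 ∨ e₂ = -1)
    (c0 : P t₁ t₂ ∨ P (v - t₂) (u - t₁))
    (c1 : P t₁ (t₂ + e₂) ∨ P (v - (t₂ + e₂)) (u - t₁))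
    (c2 : P t₁ (t₂ + e₂ * 2) ∨ P (v - (t₂ + e₂ * 2)) (u - t₁))
    (c3 : P t₁ (t₂ + e₂ * 3) ∨ P (v - (t₂ + e₂ * 3)) (u - t₁))
    (c4 : P (t₁ + e₁) (t₂ + e₂) ∨ P (v - (t₂ + e₂)) (u - (t₁ + e₁))) : Win P := by
  refine ⟨u, v, hd, t₁, t₂, e₁, e₂, false, h₁, h₂, ?_⟩
  rintro i j (⟨rfl, rfl⟩ | ⟨rfl, rfl⟩ | ⟨rfl, rfl⟩ | ⟨rfl, rfl⟩ | ⟨rfl, rfl⟩)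
  · exact ⟨_, _, by simp, c0⟩
  · exact ⟨_, _, by simp, c1⟩
  · exact ⟨_, _, by simp, c2⟩
  · exact ⟨_, _, by simp, c3⟩
  · exact ⟨_, _, by simp, c4⟩

/-- horizontal bar with cells `(t₁ + e₁ j, t₂)`, bump `(t₁ + e₁, t₂ + e₂)`. -/
theorem win_h {P : ℤ → ℤ → Prop} (u v : ℤ) (hd : ∀ x y, P x y → ¬ P (u - y) (v - x))
    (t₁ t₂ e₁ e₂ : ℤ) (h₁ : e₁ = 1 ∨ e₁ = -1) (h₂ : e₂ = 1 ∨ e₂ = -1)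
    (c0 : P t₁ t₂ ∨ P (v - t₂) (u - t₁))
    (c1 : P (t₁ + e₁) t₂ ∨ P (v - t₂) (u - (t₁ + e₁)))
    (c2 : P (t₁ + e₁ * 2) t₂ ∨ P (v - t₂) (u - (t₁ + e₁ * 2)))
    (c3 : P (t₁ + e₁ * 3) t₂ ∨ P (v - t₂) (u - (t₁ + e₁ * 3)))
    (c4 : P (t₁ + e₁) (t₂ + e₂) ∨ P (v - (t₂ + e₂)) (u - (t₁ + e₁))) : Win P := by
  refine ⟨u, v, hd, t₁, t₂, e₁, e₂, true, h₁, h₂, ?_⟩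
  rintro i j (⟨rfl, rfl⟩ | ⟨rfl, rfl⟩ | ⟨rfl, rfl⟩ | ⟨rfl, rfl⟩ | ⟨rfl, rfl⟩)
  · exact ⟨_, _, by simp, c0⟩
  · exact ⟨_, _, by simp, c1⟩
  · exact ⟨_, _, by simp, c2⟩
  · exact ⟨_, _, by simp, c3⟩
  · exact ⟨_, _, by simp, c4⟩

theorem win_swap {P : ℤ → ℤ → Prop} (h : Win (fun x y => P y x)) : Win P := by
  obtain ⟨u, v, hd, t₁, t₂, e₁, e₂, s, h₁, h₂, hY⟩ := h
  refine ⟨v, u, fun x y hp => hd y x hp, t₂, t₁, e₂, e₁, !s, h₂, h₁, ?_⟩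
  intro i j hij
  obtain ⟨x, y, hxy, hc⟩ := hY i j hij
  refine ⟨y, x, ?_, hc⟩
  cases s <;> simp at hxy ⊢ <;> exact ⟨hxy.2, hxy.1⟩

/-- Every set of at most three cells of `P` has a neighbour in `P`. -/
def Grow (P : ℤ → ℤ → Prop) : Prop :=
  ∀ a b a' b' a'' b'' : ℤ, P a b → P a' b' → P a'' b'' →
    ∃ x y : ℤ, P x y ∧ ¬ (x = a ∧ y = b) ∧ ¬ (x = a' ∧ y = b') ∧ ¬ (x = a'' ∧ y = b'') ∧
      ∃ c d : ℤ, ((c = a ∧ d = b) ∨ (c = a' ∧ d = b') ∨ (c = a'' ∧ d = b'')) ∧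
        ((x = c - 1 ∧ y = d) ∨ (x = c + 1 ∧ y = d) ∨ (x = c ∧ y = d - 1) ∨ (x = c ∧ y = d + 1))

theorem grow_swap {P : ℤ → ℤ → Prop} (h : Grow P) : Grow (fun x y => P y x) := by
  intro a b a' b' a'' b'' h1 h2 h3
  obtain ⟨x, y, hp, n1, n2, n3, c, d, hcd, hx⟩ := h b a b' a' b'' a'' h1 h2 h3
  refine ⟨y, x, hp, fun h => n1 h.symm, fun h => n2 h.symm, fun h => n3 h.symm, d, c, ?_, ?_⟩
  · rcases hcd with h | h | h
    · exact .inl h.symm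
    · exact .inr (.inl h.symm)
    · exact .inr (.inr h.symm)
  · rcases hx with h | h | h | h
    · exact .inr (.inr (.inl h.symm))
    · exact .inr (.inr (.inr h.symm))
    · exact .inl h.symm
    · exact .inr (.inl h.symm)

section
variable {P : ℤ → ℤ → Prop} {M : ℤ}

theorem disj_out (hM : ∀ x y, P x y → x + y ≤ M) (u v : ℤ) (h : u + v = 2 * M + 1) :
    ∀ x y, P x y → ¬ P (u - y) (v - x) := by
  intro x y h1 h2
  have := hM _ _ h1
  have := hM _ _ h2
  omega

/-- Step 1: an extreme cell with both neighbours. -/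
theorem step1 (hM : ∀ x y, P x y → x + y ≤ M) (a b : ℤ) (hab : a + b = M)
    (h0 : P a b) (hW : P (a - 1) b) (hS : P a (b - 1)) : Win P := by
  refine win_h (a + b + 1) (a + b) (disj_out hM _ _ (by omega)) (a - 1) b 1 (-1)
    (by simp) (by simp) (.inl hW) (.inl (tp h0 (by omega) (by omega)))
    (.inr (tp h0 (by omega) (by omega))) (.inr (tp hS (by omega) (by omega)))
    (.inl (tp hS (by omega) (by omega)))

theorem nbr (hM : ∀ x y, P x y → x + y ≤ M) (hG : Grow P) (a b : ℤ) (hab : a + b = M)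
    (h0 : P a b) : P (a - 1) b ∨ P a (b - 1) := by
  obtain ⟨x, y, hp, n1, n2, n3, c, d, hcd, hx⟩ := hG a b a b a b h0 h0 h0
  have := hM _ _ hp
  have hc : c = a ∧ d = b := by tauto
  obtain ⟨rfl, rfl⟩ := hc
  rcases hx with ⟨rfl, rfl⟩ | ⟨rfl, rfl⟩ | ⟨rfl, rfl⟩ | ⟨rfl, rfl⟩
  · exact .inl hp
  · omega
  · exact .inr hp
  · omega

/-- Step 2: consecutive extreme cells. -/
theorem step2 (hM : ∀ x y, P x y → x + y ≤ M) (hG : Grow P) (a b : ℤ) (hab : a + b = M)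
    (h0 : P a b) (h1 : P (a - 1) (b + 1)) : Win P := by
  by_cases hW : P (a - 1) b
  · obtain ⟨x, y, hp, n1, n2, n3, c, d, hcd, hx⟩ := hG a b (a - 1) b (a - 1) (b + 1) h0 hW h1
    have hs := hM _ _ hp
    have key : (x = a ∧ y = b - 1) ∨ (x = a - 2 ∧ y = b + 1) ∨ (x = a - 2 ∧ y = b) ∨
        (x = a - 1 ∧ y = b - 1) := by omega
    rcases key with ⟨e1, e2⟩ | ⟨e1, e2⟩ | ⟨e1, e2⟩ | ⟨e1, e2⟩
    all_goals rw [e1, e2] at hp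
    · exact step1 hM _ _ hab h0 hW hp
    · exact step1 hM (a - 1) (b + 1) (by omega) h1 (tp hp (by omega) (by omega))
        (tp hW (by omega) (by omega))
    · exact win_h (a + b + 1) (a + b) (disj_out hM _ _ (by omega)) (a - 2) b 1 1
        (by simp) (by simp) (.inl hp) (.inl (tp hW (by omega) (by omega)))
        (.inl (tp h0 (by omega) (by omega))) (.inr (tp h0 (by omega) (by omega)))
        (.inl (tp h1 (by omega) (by omega)))
    · exact win_v (a + b) (a + b + 1) (disj_out hM _ _ (by omega)) (a - 1) (b - 1) 1 1
        (by simp) (by simp) (.inl hp) (.inl (tp hW (by omega) (by omega)))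
        (.inl (tp h1 (by omega) (by omega))) (.inr (tp h1 (by omega) (by omega)))
        (.inl (tp h0 (by omega) (by omega)))
  · have hS : P a (b - 1) := (nbr hM hG a b hab h0).resolve_left hW
    have hW' : P (a - 2) (b + 1) := by
      rcases nbr hM hG (a - 1) (b + 1) (by omega) h1 with h | h
      · exact tp h (by omega) (by omega)
      · exact absurd (tp h (by omega) (by omega)) hW
    exact win_v (a + b + 1) (a + b) (disj_out hM _ _ (by omega)) a (b + 2) (-1) (-1)
      (by simp) (by simp) (.inr (tp hW' (by omega) (by omega)))
      (.inr (tp h1 (by omega) (by omega))) (.inl (tp h0 (by omega) (by omega)))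
      (.inl (tp hS (by omega) (by omega))) (.inl (tp h1 (by omega) (by omega)))

theorem disj_on (hM : ∀ x y, P x y → x + y ≤ M)
    (hI : ∀ a b, a + b = M → P a b → ¬ P (a - 1) (b + 1)) (u v : ℤ)
    (h : (u = M + 1 ∧ v = M - 1) ∨ (u = M - 1 ∧ v = M + 1)) :
    ∀ x y, P x y → ¬ P (u - y) (v - x) := by
  intro x y h1 h2
  have e1 := hM _ _ h1
  have e2 := hM _ _ h2
  have e : x + y = M := by omega
  rcases h with ⟨rfl, rfl⟩ | ⟨rfl, rfl⟩
  · exact hI _ _ (by omega) h2 (tp h1 (by omega) (by omega))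
  · exact hI _ _ e h1 (tp h2 (by omega) (by omega))

/-- Step 3: structure of an extreme leaf with a western neighbour. -/
theorem step3 (hM : ∀ x y, P x y → x + y ≤ M) (hG : Grow P)
    (hI : ∀ a b, a + b = M → P a b → ¬ P (a - 1) (b + 1))
    (a b : ℤ) (hab : a + b = M) (h0 : P a b) (hW : P (a - 1) b) (hn : ¬ Win P) :
    P (a - 2) b ∧ P (a - 2) (b - 1) ∧ ¬ P (a - 2) (b + 1) ∧ ¬ P (a + 1) (b - 2) := by
  have dp := disj_on hM hI (M + 1) (M - 1) (.inl ⟨rfl, rfl⟩)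
  have dm := disj_on hM hI (M - 1) (M + 1) (.inr ⟨rfl, rfl⟩)
  have hS : ¬ P a (b - 1) := fun h => hn (step1 hM a b hab h0 hW h)
  have hN : ¬ P (a - 1) (b + 1) := hI a b hab h0
  have hA : ¬ P (a - 1) (b - 1) := fun h => hn <|
    win_v _ _ dm (a - 1) (b - 1) 1 1 (by simp) (by simp) (.inl h)
      (.inl (tp hW (by omega) (by omega))) (.inr (tp h0 (by omega) (by omega)))
      (.inr (tp hW (by omega) (by omega))) (.inl (tp h0 (by omega) (by omega)))
  have hB : P (a - 2) b := by
    obtain ⟨x, y, hp, n1, n2, n3, c, d, hcd, hx⟩ := hG a b (a - 1) b (a - 1) b h0 hW hW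
    have hs := hM _ _ hp
    have key : (x = a ∧ y = b - 1) ∨ (x = a - 1 ∧ y = b + 1) ∨ (x = a - 2 ∧ y = b) ∨
        (x = a - 1 ∧ y = b - 1) := by omega
    rcases key with ⟨e1, e2⟩ | ⟨e1, e2⟩ | ⟨e1, e2⟩ | ⟨e1, e2⟩
    all_goals rw [e1, e2] at hp
    · exact absurd hp hS
    · exact absurd hp hN
    · exact hp
    · exact absurd hp hA
  have hC : ¬ P (a - 2) (b + 1) := fun h => hn <|
    win_h _ _ dp (a + 1) b (-1) 1 (by simp) (by simp) (.inr (tp hW (by omega) (by omega)))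
      (.inl (tp h0 (by omega) (by omega))) (.inl (tp hW (by omega) (by omega)))
      (.inl (tp hB (by omega) (by omega))) (.inr (tp h (by omega) (by omega)))
  have hD : ¬ P (a - 3) b := fun h => hn <|
    win_v _ _ dp (a + 1) (b - 1) (-1) 1 (by simp) (by simp) (.inr (tp h0 (by omega) (by omega)))
      (.inr (tp hW (by omega) (by omega))) (.inr (tp hB (by omega) (by omega)))
      (.inr (tp h (by omega) (by omega))) (.inl (tp h0 (by omega) (by omega)))
  have hE : P (a - 2) (b - 1) := by
    obtain ⟨x, y, hp, n1, n2, n3, c, d, hcd, hx⟩ := hG a b (a - 1) b (a - 2) b h0 hW hB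
    have hs := hM _ _ hp
    have key : (x = a ∧ y = b - 1) ∨ (x = a - 1 ∧ y = b + 1) ∨ (x = a - 2 ∧ y = b + 1) ∨
        (x = a - 1 ∧ y = b - 1) ∨ (x = a - 3 ∧ y = b) ∨ (x = a - 2 ∧ y = b - 1) := by omega
    rcases key with ⟨e1, e2⟩ | ⟨e1, e2⟩ | ⟨e1, e2⟩ | ⟨e1, e2⟩ | ⟨e1, e2⟩ | ⟨e1, e2⟩
    all_goals rw [e1, e2] at hp
    · exact absurd hp hS
    · exact absurd hp hN
    · exact absurd hp hC
    · exact absurd hp hA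
    · exact absurd hp hD
    · exact hp
  refine ⟨hB, hE, hC, fun h => hn <|
    win_v _ _ dp (a + 1) (b + 1) (-1) (-1) (by simp) (by simp)
      (.inr (tp hB (by omega) (by omega))) (.inr (tp hW (by omega) (by omega)))
      (.inr (tp h0 (by omega) (by omega))) (.inl (tp h (by omega) (by omega)))
      (.inl (tp h0 (by omega) (by omega)))⟩

theorem final_W (hM : ∀ x y, P x y → x + y ≤ M)
    (hF : ∀ a b, a + b = M → P a b → ¬ P (a - 2) (b + 1) ∧ ¬ P (a + 1) (b - 2))
    (a b : ℤ) (hab : a + b = M) (h0 : P a b) (hW : P (a - 1) b)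
    (hB : P (a - 2) b) (hE : P (a - 2) (b - 1)) : Win P := by
  have dd : ∀ x y, P x y → ¬ P ((M + 1) - y) ((M - 2) - x) := by
    intro x y h1 h2
    have e1 := hM _ _ h1
    have e2 := hM _ _ h2
    by_cases e : x + y = M
    · exact (hF x y e h1).2 (tp h2 (by omega) (by omega))
    · exact (hF _ _ (by omega) h2).1 (tp h1 (by omega) (by omega))
  exact win_h _ _ dd (a + 2) b (-1) (-1) (by simp) (by simp)
    (.inr (tp hE (by omega) (by omega))) (.inr (tp hB (by omega) (by omega)))
    (.inl (tp h0 (by omega) (by omega))) (.inl (tp hW (by omega) (by omega)))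
    (.inr (tp hW (by omega) (by omega)))

theorem main (hM : ∀ x y, P x y → x + y ≤ M) (hG : Grow P)
    (a b : ℤ) (hab : a + b = M) (h0 : P a b) : Win P := by
  by_contra hn
  have hn' : ¬ Win (fun x y => P y x) := fun h => hn (win_swap h)
  have hG' := grow_swap hG
  have hM' : ∀ x y, (fun x y => P y x) x y → x + y ≤ M := fun x y h => by
    have := hM _ _ h
    omega
  have hI : ∀ a b, a + b = M → P a b → ¬ P (a - 1) (b + 1) :=
    fun a b hab h h' => hn (step2 hM hG a b hab h h')
  have hI' : ∀ a b, a + b = M → (fun x y => P y x) a b →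
      ¬ (fun x y => P y x) (a - 1) (b + 1) :=
    fun a b hab h h' => hn' (step2 hM' hG' a b hab h h')
  have hF : ∀ a b, a + b = M → P a b → ¬ P (a - 2) (b + 1) ∧ ¬ P (a + 1) (b - 2) := by
    intro a b hab h0
    rcases nbr hM hG a b hab h0 with h | h
    · exact (step3 hM hG hI a b hab h0 h hn).2.2
    · exact (step3 hM' hG' hI' b a (by omega) h0 h hn').2.2.symm
  rcases nbr hM hG a b hab h0 with h | h
  · have := step3 hM hG hI a b hab h0 h hn
    exact hn (final_W hM hF a b hab h0 h this.1 this.2.1)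
  · have := step3 hM' hG' hI' b a (by omega) h0 h hn'
    exact hn' (final_W hM' (fun a b hab h => (hF b a (by omega) h).symm) b a (by omega) h0 h
      this.1 this.2.1)

end

theorem adj_iff (a b : ℤ × ℤ) (h : Adjacent a b) :
    (b.1 = a.1 - 1 ∧ b.2 = a.2) ∨ (b.1 = a.1 + 1 ∧ b.2 = a.2) ∨
      (b.1 = a.1 ∧ b.2 = a.2 - 1) ∨ (b.1 = a.1 ∧ b.2 = a.2 + 1) := by
  unfold Adjacent at h
  omega

theorem exit_step {α : Type*} {r : α → α → Prop} {S : Set α} {a b : α}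
    (h : Relation.ReflTransGen r a b) (ha : a ∈ S) (hb : b ∉ S) :
    ∃ x y, r x y ∧ x ∈ S ∧ y ∉ S := by
  induction h with
  | refl => exact absurd ha hb
  | @tail c d _ hcd ih =>
    by_cases hc : c ∈ S
    · exact ⟨c, d, hcd, hc, hb⟩
    · exact ih hc

theorem grow_of {P : Set (ℤ × ℤ)} (hP : IsPolyomino P) (hN : 4 ≤ P.ncard) :
    Grow (fun x y => (x, y) ∈ P) := by
  intro a b a' b' a'' b'' h1 h2 h3
  obtain ⟨z, hz, hzS⟩ : ∃ z ∈ P, z ∉ (({(a, b), (a', b'), (a'', b'')} : Finset (ℤ × ℤ)) :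
      Set (ℤ × ℤ)) := by
    by_contra! hc
    have := Set.ncard_le_ncard (s := P) (t := (({(a, b), (a', b'), (a'', b'')} :
      Finset (ℤ × ℤ)) : Set (ℤ × ℤ))) hc (Finset.finite_toSet _)
    rw [Set.ncard_coe_finset] at this
    have := Finset.card_le_three (a := (a, b)) (b := (a', b')) (c := (a'', b''))
    omega
  obtain ⟨x, y, ⟨_, hy, hxy⟩, hxS, hyS⟩ := exit_step (hP.2.2 _ h1 _ hz)
    (S := (({(a, b), (a', b'), (a'', b'')} : Finset (ℤ × ℤ)) : Set (ℤ × ℤ))) (by simp) hzS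
  obtain ⟨x1, x2⟩ := x
  obtain ⟨y1, y2⟩ := y
  simp at hxS hyS
  exact ⟨y1, y2, hy, by tauto, by tauto, by tauto, x1, x2, hxS, adj_iff _ _ hxy⟩

end YCover

/-- The Y-pentomino is always-coverable. -/
theorem pentominoY_alwaysCoverable :
    AlwaysCoverable ({(0,0), (0,1), (0,2), (0,3), (1,1)} : Set (ℤ × ℤ)) := by
  refine ⟨4, fun P hP hN => ?_⟩
  obtain ⟨m, hm, hmax⟩ := Set.exists_max_image P (fun p => p.1 + p.2) hP.2.1 hP.1
  obtain ⟨u, v, hd, t₁, t₂, e₁, e₂, s, h₁, h₂, hY⟩ :=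
    YCover.main (P := fun x y => (x, y) ∈ P) (M := m.1 + m.2) (fun x y h => hmax _ h)
      (YCover.grow_of hP hN) m.1 m.2 rfl hm
  refine ⟨P, (fun p => (u - p.2, v - p.1)) '' P, ⟨id, ⟨(0, 0), 1, 1, false, by simp⟩, by simp⟩,
    ⟨_, ⟨(u, v), -1, -1, true, by simp, by simp, fun p => ?_⟩, rfl⟩, ?_,
    (fun p : ℤ × ℤ => if s then (t₁ + e₁ * p.2, t₂ + e₂ * p.1) else (t₁ + e₁ * p.1, t₂ + e₂ * p.2)) '' _,
    ⟨_, ⟨(t₁, t₂), e₁, e₂, s, h₁, h₂, fun p => rfl⟩, rfl⟩, ?_⟩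
  · simp [sub_eq_add_neg]
  · rw [Set.disjoint_left]
    rintro _ hp ⟨⟨x, y⟩, hq, rfl⟩
    exact hd x y hq hp
  · rintro _ ⟨⟨i, j⟩, hij, rfl⟩
    obtain ⟨x, y, hxy, hc⟩ := hY i j (by simpa using hij)
    have hxy' : (if s = true then (t₁ + e₁ * j, t₂ + e₂ * i)
            else (t₁ + e₁ * i, t₂ + e₂ * j)) = (x, y) := hxy.symm
    show (if s = true then (t₁ + e₁ * j, t₂ + e₂ * i)
            else (t₁ + e₁ * i, t₂ + e₂ * j)) ∈ _
    rw [hxy']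
    rcases hc with hc | hc
    · exact .inl hc
    · exact .inr ⟨(v - y, u - x), hc, by simp⟩
end

section
/- The pentomino T, consisting of the cells {(0,0),(1,0),(2,0),(1,1),(1,2)} in ℤ², is always-coverable. -/
namespace TP

def IsU (u : ℤ × ℤ) : Prop := u = (1,0) ∨ u = (-1,0) ∨ u = (0,1) ∨ u = (0,-1)

def Frame (t d : ℤ × ℤ) : Prop :=
  ((t = (1,0) ∨ t = (-1,0)) ∧ (d = (0,1) ∨ d = (0,-1))) ∨
  ((t = (0,1) ∨ t = (0,-1)) ∧ (d = (1,0) ∨ d = (-1,0)))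

def ip (p d : ℤ × ℤ) : ℤ := p.1 * d.1 + p.2 * d.2

lemma ip_add (p q d : ℤ × ℤ) : ip (p + q) d = ip p d + ip q d := by
  simp only [ip, Prod.fst_add, Prod.snd_add]; ring

lemma ip_neg (p d : ℤ × ℤ) : ip (-p) d = - ip p d := by
  simp only [ip, Prod.fst_neg, Prod.snd_neg]; ring

lemma ip_neg_right (p d : ℤ × ℤ) : ip p (-d) = - ip p d := by
  simp only [ip, Prod.fst_neg, Prod.snd_neg]; ring

lemma ip_smul (n : ℤ) (p d : ℤ × ℤ) : ip (n • p) d = n * ip p d := by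
  simp only [ip, Prod.smul_fst, Prod.smul_snd, smul_eq_mul]; ring

lemma Frame.symm {t d : ℤ × ℤ} (h : Frame t d) : Frame d t := by
  unfold Frame at *; tauto

lemma Frame.negl {t d : ℤ × ℤ} (h : Frame t d) : Frame (-t) d := by
  rcases h with ⟨rfl | rfl, rfl | rfl⟩ | ⟨rfl | rfl, rfl | rfl⟩ <;> simp [Frame]

lemma Frame.negr {t d : ℤ × ℤ} (h : Frame t d) : Frame t (-d) := h.symm.negl.symm

lemma Frame.ul {t d : ℤ × ℤ} (h : Frame t d) : IsU t := by
  unfold Frame at h; unfold IsU; tauto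

lemma Frame.ur {t d : ℤ × ℤ} (h : Frame t d) : IsU d := h.symm.ul

lemma IsU.neg {u : ℤ × ℤ} (h : IsU u) : IsU (-u) := by
  rcases h with rfl | rfl | rfl | rfl <;> simp [IsU]

lemma Frame.ip {t d : ℤ × ℤ} (h : Frame t d) :
    ip t d = 0 ∧ ip d t = 0 ∧ ip t t = 1 ∧ ip d d = 1 := by
  rcases h with ⟨rfl | rfl, rfl | rfl⟩ | ⟨rfl | rfl, rfl | rfl⟩ <;> simp [TP.ip]

lemma Frame.cases {t d u : ℤ × ℤ} (h : Frame t d) (hu : IsU u) :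
    u = t ∨ u = -t ∨ u = d ∨ u = -d := by
  rcases h with ⟨rfl | rfl, rfl | rfl⟩ | ⟨rfl | rfl, rfl | rfl⟩ <;>
  rcases hu with rfl | rfl | rfl | rfl <;> simp

lemma Frame.ext {t d p q : ℤ × ℤ} (h : Frame t d) (h1 : TP.ip p t = TP.ip q t)
    (h2 : TP.ip p d = TP.ip q d) : p = q := by
  rcases h with ⟨rfl | rfl, rfl | rfl⟩ | ⟨rfl | rfl, rfl | rfl⟩ <;>
  simp [TP.ip] at h1 h2 <;> ext <;> assumption

lemma adj_iff {p q : ℤ × ℤ} (h : Adjacent p q) : ∃ u, IsU u ∧ q = p + u := by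
  refine ⟨q - p, ?_, by abel⟩
  obtain ⟨a, b⟩ := p
  obtain ⟨c, d⟩ := q
  simp only [Adjacent, IsU, Prod.mk_sub_mk, Prod.mk.injEq] at *
  omega

/-- `p` reaches the set `X` within `P` in `n` steps. -/
def R (P X : Set (ℤ × ℤ)) : ℕ → ℤ × ℤ → Prop
  | 0, p => p ∈ X
  | n+1, p => ∃ u, IsU u ∧ p + u ∈ P ∧ R P X n (p + u)

lemma R_step {P X : Set (ℤ × ℤ)} {n : ℕ} {p u q : ℤ × ℤ} (hu : IsU u) (hq : q ∈ P)
    (h : R P X n q) (e : p + u = q) : R P X (n+1) p := by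
  subst e; exact ⟨u, hu, hq, h⟩

def Side (P A : Set (ℤ × ℤ)) (t d : ℤ × ℤ) : Prop :=
  A ⊆ P ∧ Frame t d ∧ ∀ a ∈ A, a + d ∉ P ∧ (a + t ∈ P → a + t ∈ A) ∧
    (a + -t ∈ P → a + -t ∈ A) ∧ ¬ (a + t ∈ P ∧ a + -t ∈ P) ∧
    ¬ (a + -d ∈ P ∧ a + -d + t ∈ P ∧ a + -d + -t ∈ P)

lemma Side.neg {P A : Set (ℤ × ℤ)} {t d : ℤ × ℤ} (h : Side P A t d) : Side P A (-t) d := by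
  refine ⟨h.1, h.2.1.negl, fun a ha => ?_⟩
  have := h.2.2 a ha
  simp only [neg_neg]
  tauto

def TFree (P : Set (ℤ × ℤ)) : Prop := ∀ c t u, Frame t u →
  c ∈ P → c + t ∈ P → c + -t ∈ P → c + u ∈ P → c + u + u ∈ P → False

lemma stem {P A B C : Set (ℤ × ℤ)} (hT : TFree P) {c t u t0 d0 : ℤ × ℤ} {i j k n : ℕ}
    (hA : Side P A t0 d0) (hF : Frame t u) (hc : c ∈ P) (hu : c + u ∈ P) (ht : c + t ∈ P)
    (ht' : c + -t ∈ P) (ra : R P A i (c + u)) (rb : R P B j (c + t)) (rc : R P C k (c + -t))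
    (hn : n = i + j + k + 3)
    (hmin : ∀ c' ∈ P, ∀ i' j' k', R P A i' c' → R P B j' c' → R P C k' c' → n ≤ i' + j' + k') :
    False := by
  have rbc : R P B (j+1) c := ⟨t, hF.ul, ht, rb⟩
  have rcc : R P C (k+1) c := ⟨-t, hF.ul.neg, ht', rc⟩
  rcases i with _ | i
  · have ha : c + u ∈ A := ra
    obtain ⟨h1, h2, h3, h4, h5⟩ := hA.2.2 _ ha
    have key : c ∉ A := fun h => by
      have := hmin c hc 0 _ _ h rbc rcc; omega
    rcases hA.2.1.cases hF.ur with rfl | rfl | rfl | rfl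
    · rw [add_neg_cancel_right] at h3; exact key (h3 hc)
    · rw [neg_add_cancel_right] at h2; exact key (h2 hc)
    · rw [add_neg_cancel_right] at h5
      rcases hA.2.1.cases hF.ul with rfl | rfl | rfl | rfl
      · exact h5 ⟨hc, ht, ht'⟩
      · rw [neg_neg] at ht'; exact h5 ⟨hc, ht', ht⟩
      · have := hF.ip; omega
      · have := hF.ip; rw [ip_neg] at this; omega
    · rw [neg_add_cancel_right] at h1; exact h1 hc
  · obtain ⟨v, hv, hvP, rv⟩ := ra
    rcases hF.cases hv with rfl | rfl | rfl | rfl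
    · have := hmin (c + v) ht _ _ _
        (R_step hF.ur hvP rv (by abel)) rb (R_step hF.ul.neg hc rcc (by abel))
      omega
    · have := hmin (c + -t) ht' _ _ _
        (R_step hF.ur hvP rv (by abel)) (R_step hF.ul hc rbc (by abel)) rc
      omega
    · exact hT c t v hF hc ht ht' hu hvP
    · rw [add_neg_cancel_right] at rv
      have := hmin c hc _ _ _ rv rbc rcc
      omega

lemma zero' {P A B C : Set (ℤ × ℤ)} {c t d : ℤ × ℤ} {j k n : ℕ}
    (hA : Side P A t d) (hc : c ∈ A) (h1P : c + t ∈ P) (h2P : c + -d ∈ P)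
    (rb : R P B j (c + t)) (rc : R P C k (c + -d)) (hn : n = j + k + 2)
    (hAB : ∀ x ∈ A, x ∉ B)
    (hmin : ∀ c' ∈ P, ∀ i' j' k', R P A i' c' → R P B j' c' → R P C k' c' → n ≤ i' + j' + k') :
    False := by
  have hF := hA.2.1
  have hcP := hA.1 hc
  have hc' : c + t ∈ A := (hA.2.2 c hc).2.1 h1P
  rcases j with _ | j
  · exact hAB _ hc' rb
  obtain ⟨v, hv, hvP, rv⟩ := rb
  obtain ⟨h1, h2, h3, h4, h5⟩ := hA.2.2 _ hc'
  rcases hF.cases hv with rfl | rfl | rfl | rfl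
  · rw [add_neg_cancel_right] at h4; exact h4 ⟨hvP, hcP⟩
  · rw [add_neg_cancel_right] at rv
    have := hmin c hcP 0 _ _ hc rv (R_step hF.ur.neg h2P rc rfl)
    omega
  · exact h1 hvP
  · have := hmin _ hvP 1 _ _ (R_step (q := c + t) (n := 0) hF.ur h1P hc' (by abel)) rv
      (R_step hF.ul.neg h2P rc (by abel))
    omega

lemma zero {P A B C : Set (ℤ × ℤ)} {c t d v w : ℤ × ℤ} {j k n : ℕ}
    (hA : Side P A t d) (hc : c ∈ A) (hv : IsU v) (hw : IsU w) (h1P : c + v ∈ P) (h2P : c + w ∈ P)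
    (rb : R P B j (c + v)) (rc : R P C k (c + w)) (hn : n = j + k + 2)
    (hAB : ∀ x ∈ A, x ∉ B) (hAC : ∀ x ∈ A, x ∉ C)
    (hmin : ∀ c' ∈ P, ∀ i' j' k', R P A i' c' → R P B j' c' → R P C k' c' → n ≤ i' + j' + k') :
    False := by
  have hF := hA.2.1
  have hcP := hA.1 hc
  have hne : v ≠ w := by
    rintro rfl
    have := hmin _ h1P 1 _ _ (R_step (q := c) (n := 0) hv.neg hcP hc (by abel)) rb rc
    omega
  have hmin' : ∀ c' ∈ P, ∀ i' j' k', R P A i' c' → R P C j' c' → R P B k' c' →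
      n ≤ i' + j' + k' := fun c' h i' j' k' x y z => by
    have := hmin c' h _ _ _ x z y; omega
  obtain ⟨h1, h2, h3, h4, h5⟩ := hA.2.2 _ hc
  rcases hF.cases hv with rfl | rfl | rfl | rfl <;> rcases hF.cases hw with h | h | h | h <;>
    subst h
  · exact hne rfl
  · exact h4 ⟨h1P, h2P⟩
  · exact h1 h2P
  · exact zero' hA hc h1P h2P rb rc hn hAB hmin
  · exact h4 ⟨h2P, h1P⟩
  · exact hne rfl
  · exact h1 h2P
  · exact zero' hA.neg hc h1P h2P rb rc hn hAB hmin
  · exact h1 h1P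
  · exact h1 h1P
  · exact h1 h1P
  · exact h1 h1P
  · exact zero' hA hc h2P h1P rc rb (by omega) hAC hmin'
  · exact zero' hA.neg hc h2P h1P rc rb (by omega) hAC hmin'
  · exact h1 h2P
  · exact hne rfl

lemma three {u v w : ℤ × ℤ} (hu : IsU u) (hv : IsU v) (hw : IsU w) (h1 : u ≠ v) (h2 : u ≠ w)
    (h3 : v ≠ w) : (Frame v u ∧ w = -v) ∨ (Frame u v ∧ w = -u) ∨ (Frame u w ∧ v = -u) := by
  rcases hu with rfl | rfl | rfl | rfl <;> rcases hv with rfl | rfl | rfl | rfl <;>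
  rcases hw with rfl | rfl | rfl | rfl <;> simp [Frame] at *

lemma exists_R {P X : Set (ℤ × ℤ)} (hP : IsPolyomino P) (hX : X ⊆ P) (hne : X.Nonempty)
    {p : ℤ × ℤ} (hp : p ∈ P) : ∃ n, R P X n p := by
  obtain ⟨x, hx⟩ := hne
  have := hP.2.2 p hp x (hX hx)
  induction this using Relation.ReflTransGen.head_induction_on with
  | refl => exact ⟨0, hx⟩
  | head h _ ih =>
    obtain ⟨h1, h2, h3⟩ := h
    obtain ⟨u, hu, rfl⟩ := adj_iff h3
    obtain ⟨n, hn⟩ := ih h2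
    exact ⟨n+1, u, hu, h2, hn⟩

lemma steiner {P A B C : Set (ℤ × ℤ)} (hP : IsPolyomino P) (hT : TFree P)
    {t1 d1 t2 d2 t3 d3 : ℤ × ℤ}
    (hA : Side P A t1 d1) (hB : Side P B t2 d2) (hC : Side P C t3 d3)
    (nA : A.Nonempty) (nB : B.Nonempty) (nC : C.Nonempty)
    (hAB : ∀ x ∈ A, x ∉ B) (hAC : ∀ x ∈ A, x ∉ C) (hBC : ∀ x ∈ B, x ∉ C) : False := by
  classical
  have hex : ∃ n, ∃ c ∈ P, ∃ i j k, R P A i c ∧ R P B j c ∧ R P C k c ∧ n = i + j + k := by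
    obtain ⟨p, hp⟩ := hP.1
    obtain ⟨i, hi⟩ := exists_R hP hA.1 nA hp
    obtain ⟨j, hj⟩ := exists_R hP hB.1 nB hp
    obtain ⟨k, hk⟩ := exists_R hP hC.1 nC hp
    exact ⟨_, p, hp, i, j, k, hi, hj, hk, rfl⟩
  obtain ⟨c, hc, i, j, k, ra, rb, rc, hn⟩ := Nat.find_spec hex
  have hmin : ∀ c' ∈ P, ∀ i' j' k', R P A i' c' → R P B j' c' → R P C k' c' →
      Nat.find hex ≤ i' + j' + k' := fun c' h i' j' k' x y z =>
    Nat.find_min' hex ⟨c', h, i', j', k', x, y, z, rfl⟩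
  generalize Nat.find hex = n at hn hmin
  rcases i with _ | i
  · rcases j with _ | j
    · exact hAB c ra rb
    rcases k with _ | k
    · exact hAC c ra rc
    obtain ⟨v, hv, hvP, rv⟩ := rb
    obtain ⟨w, hw, hwP, rw⟩ := rc
    exact zero (n := n) hA ra hv hw hvP hwP rv rw (by omega) hAB hAC hmin
  rcases j with _ | j
  · rcases k with _ | k
    · exact hBC c rb rc
    obtain ⟨v, hv, hvP, rv⟩ := ra
    obtain ⟨w, hw, hwP, rw⟩ := rc
    exact zero (n := n) hB rb hv hw hvP hwP rv rw (by omega) (fun x h h' => hAB x h' h) hBC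
      (fun c' h i' j' k' x y z => by have := hmin c' h _ _ _ y x z; omega)
  obtain ⟨u, hu, huP, ru⟩ := ra
  obtain ⟨v, hv, hvP, rv⟩ := rb
  rcases k with _ | k
  · exact zero (n := n) hC rc hu hv huP hvP ru rv (by omega) (fun x h h' => hAC x h' h)
      (fun x h h' => hBC x h' h)
      (fun c' h i' j' k' x y z => by have := hmin c' h _ _ _ y z x; omega)
  obtain ⟨w, hw, hwP, rw⟩ := rc
  have e1 : u ≠ v := by
    rintro rfl
    have := hmin _ huP _ _ _ ru rv (R_step hu.neg hc (R_step hw hwP rw rfl) (by abel))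
    omega
  have e2 : u ≠ w := by
    rintro rfl
    have := hmin _ huP _ _ _ ru (R_step hu.neg hc (R_step hv hvP rv rfl) (by abel)) rw
    omega
  have e3 : v ≠ w := by
    rintro rfl
    have := hmin _ hvP _ _ _ (R_step hv.neg hc (R_step hu huP ru rfl) (by abel)) rv rw
    omega
  rcases three hu hv hw e1 e2 e3 with ⟨hF, rfl⟩ | ⟨hF, rfl⟩ | ⟨hF, rfl⟩
  · exact stem (n := n) hT hA hF hc huP hvP hwP ru rv rw (by omega) hmin
  · exact stem (n := n) hT hB hF hc hvP huP hwP rv ru rw (by omega)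
      (fun c' h i' j' k' x y z => by have := hmin c' h _ _ _ y x z; omega)
  · exact stem (n := n) hT hC hF hc hwP huP hvP rw ru rv (by omega)
      (fun c' h i' j' k' x y z => by have := hmin c' h _ _ _ y z x; omega)

/-! Placements -/

def Cov (P : Set (ℤ × ℤ)) : Prop :=
  ∃ P₁ P₂ : Set (ℤ × ℤ), CongruentCopy P₁ P ∧ CongruentCopy P₂ P ∧
      Disjoint P₁ P₂ ∧ ∃ Q' : Set (ℤ × ℤ),
        CongruentCopy Q' ({(0,0), (1,0), (2,0), (1,1), (1,2)} : Set (ℤ × ℤ)) ∧ Q' ⊆ P₁ ∪ P₂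

lemma copy (P : Set (ℤ × ℤ)) (a : ℤ × ℤ) {t d : ℤ × ℤ} (h : Frame t d) :
    CongruentCopy {z | a + z.1 • t + z.2 • d ∈ P} P := by
  refine ⟨fun p => (ip (p - a) t, ip (p - a) d), ?_, ?_⟩
  · obtain ⟨a1, a2⟩ := a
    rcases h with ⟨rfl | rfl, rfl | rfl⟩ | ⟨rfl | rfl, rfl | rfl⟩
    · exact ⟨(-a1, -a2), 1, 1, false, by simp, by simp, fun p => by simp [ip]; omega⟩
    · exact ⟨(-a1, a2), 1, -1, false, by simp, by simp, fun p => by simp [ip]; omega⟩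
    · exact ⟨(a1, -a2), -1, 1, false, by simp, by simp, fun p => by simp [ip]; omega⟩
    · exact ⟨(a1, a2), -1, -1, false, by simp, by simp, fun p => by simp [ip]; omega⟩
    · exact ⟨(-a2, -a1), 1, 1, true, by simp, by simp, fun p => by simp [ip]; omega⟩
    · exact ⟨(-a2, a1), 1, -1, true, by simp, by simp, fun p => by simp [ip]; omega⟩
    · exact ⟨(a2, -a1), -1, 1, true, by simp, by simp, fun p => by simp [ip]; omega⟩
    · exact ⟨(a2, a1), -1, -1, true, by simp, by simp, fun p => by simp [ip]; omega⟩
  · have hi := h.ip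
    ext z
    simp only [Set.mem_ofPred_eq, Set.mem_image]
    constructor
    · intro hz
      refine ⟨_, hz, ?_⟩
      have : a + z.1 • t + z.2 • d - a = z.1 • t + z.2 • d := by abel
      rw [this]
      ext <;> simp only [ip_add, ip_smul, hi] <;> ring
    · rintro ⟨p, hp, rfl⟩
      convert hp using 1
      apply h.ext <;> simp only [ip_add, ip_smul, hi, sub_eq_add_neg, ip_neg] <;> ring

lemma copyT (c : ℤ × ℤ) {t u : ℤ × ℤ} (h : Frame t u) :
    CongruentCopy {c, c + t, c + -t, c + u, c + u + u}
      ({(0,0), (1,0), (2,0), (1,1), (1,2)} : Set (ℤ × ℤ)) := by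
  refine ⟨fun p => c + (p.1 - 1) • t + p.2 • u, ?_, ?_⟩
  · obtain ⟨a1, a2⟩ := c
    rcases h with ⟨rfl | rfl, rfl | rfl⟩ | ⟨rfl | rfl, rfl | rfl⟩
    · exact ⟨(a1 - 1, a2), 1, 1, false, by simp, by simp, fun p => by simp; try omega⟩
    · exact ⟨(a1 - 1, a2), 1, -1, false, by simp, by simp, fun p => by simp; try omega⟩
    · exact ⟨(a1 + 1, a2), -1, 1, false, by simp, by simp, fun p => by simp; try omega⟩
    · exact ⟨(a1 + 1, a2), -1, -1, false, by simp, by simp, fun p => by simp; try omega⟩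
    · exact ⟨(a1, a2 - 1), 1, 1, true, by simp, by simp, fun p => by simp; try omega⟩
    · exact ⟨(a1, a2 - 1), -1, 1, true, by simp, by simp, fun p => by simp; try omega⟩
    · exact ⟨(a1, a2 + 1), 1, -1, true, by simp, by simp, fun p => by simp; try omega⟩
    · exact ⟨(a1, a2 + 1), -1, -1, true, by simp, by simp, fun p => by simp; try omega⟩
  · simp only [Set.image_insert_eq, Set.image_singleton]
    have e1 : c + ((0:ℤ) - 1) • t + (0:ℤ) • u = c + -t := by module
    have e2 : c + ((1:ℤ) - 1) • t + (0:ℤ) • u = c := by module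
    have e3 : c + ((2:ℤ) - 1) • t + (0:ℤ) • u = c + t := by module
    have e4 : c + ((1:ℤ) - 1) • t + (1:ℤ) • u = c + u := by module
    have e5 : c + ((1:ℤ) - 1) • t + (2:ℤ) • u = c + u + u := by module
    rw [e1, e2, e3, e4, e5]
    ext z
    simp only [Set.mem_insert_iff, Set.mem_singleton_iff]
    tauto

lemma cov_of {P : Set (ℤ × ℤ)} {a t d b s e : ℤ × ℤ} (h : Frame t d) (h' : Frame s e)
    (hd : ∀ z : ℤ × ℤ, a + z.1 • t + z.2 • d ∈ P → b + z.1 • s + z.2 • e ∈ P → False)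
    (c v u : ℤ × ℤ) (hF : Frame v u)
    (hQ : ∀ z ∈ ({c, c + v, c + -v, c + u, c + u + u} : Set (ℤ × ℤ)),
      a + z.1 • t + z.2 • d ∈ P ∨ b + z.1 • s + z.2 • e ∈ P) : Cov P :=
  ⟨_, _, copy P a h, copy P b h', Set.disjoint_left.2 fun z hz hz' => hd z hz hz', _,
    copyT c hF, hQ⟩

def Top (P : Set (ℤ × ℤ)) (d : ℤ × ℤ) : Set (ℤ × ℤ) :=
  {p | p ∈ P ∧ ∀ q ∈ P, ip q d ≤ ip p d}

lemma top_nonempty {P : Set (ℤ × ℤ)} (hP : IsPolyomino P) (d : ℤ × ℤ) : (Top P d).Nonempty := by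
  obtain ⟨x, hx, h⟩ := Set.exists_max_image P (fun q => ip q d) hP.2.1 hP.1
  exact ⟨x, hx, h⟩

lemma exit {P : Set (ℤ × ℤ)} (hP : IsPolyomino P) (K : Set (ℤ × ℤ)) {p q : ℤ × ℤ}
    (hp : p ∈ P) (hpK : p ∈ K) (hq : q ∈ P) (hqK : q ∉ K) :
    ∃ x u, x ∈ P ∧ x ∈ K ∧ IsU u ∧ x + u ∈ P ∧ x + u ∉ K := by
  have := hP.2.2 p hp q hq
  by_contra hcon
  push Not at hcon
  apply hqK
  clear hqK
  induction this with
  | refl => exact hpK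
  | tail _ h ih =>
    obtain ⟨h1, h2, h3⟩ := h
    obtain ⟨u, hu, rfl⟩ := adj_iff h3
    exact hcon _ _ h1 (ih h1) hu h2

lemma exit_card {P : Set (ℤ × ℤ)} (hP : IsPolyomino P) (hN : 5 ≤ P.ncard) (x1 x2 x3 x4 : ℤ × ℤ)
    (hx : x1 ∈ P) :
    ∃ x u, x ∈ P ∧ (x = x1 ∨ x = x2 ∨ x = x3 ∨ x = x4) ∧ IsU u ∧ x + u ∈ P ∧
      x + u ≠ x1 ∧ x + u ≠ x2 ∧ x + u ≠ x3 ∧ x + u ≠ x4 := by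
  have : ∃ q ∈ P, q ∉ ({x1, x2, x3, x4} : Set (ℤ × ℤ)) := by
    by_contra hcon
    push Not at hcon
    have h1 : P.ncard ≤ ({x1, x2, x3, x4} : Set (ℤ × ℤ)).ncard :=
      Set.ncard_le_ncard hcon (by simp)
    have h2 := Set.ncard_insert_le x1 {x2, x3, x4}
    have h3 := Set.ncard_insert_le x2 {x3, x4}
    have h4 := Set.ncard_insert_le x3 {x4}
    rw [Set.ncard_singleton] at h4
    omega
  obtain ⟨q, hq, hqK⟩ := this
  obtain ⟨x, u, h1, h2, h3, h4, h5⟩ := exit hP {x1, x2, x3, x4} hx (by simp) hq hqK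
  simp only [Set.mem_insert_iff, Set.mem_singleton_iff, not_or] at h2 h5
  exact ⟨x, u, h1, h2, h3, h4, h5⟩

lemma far {P : Set (ℤ × ℤ)} {d : ℤ × ℤ} {a x : ℤ × ℤ} (ha : a ∈ Top P d) (hx : x ∈ P) :
    ip x d ≤ ip a d := ha.2 x hx

lemma no_up {P : Set (ℤ × ℤ)} {t d a : ℤ × ℤ} (hF : Frame t d) (ha : a ∈ Top P d) :
    a + d ∉ P := fun h => by
  have := far ha h
  rw [ip_add, hF.ip.2.2.2] at this
  omega

/-- gluing along a line: (ii) -/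
lemma cov2 {P : Set (ℤ × ℤ)} {t d a : ℤ × ℤ} (hF : Frame t d) (ha : a ∈ Top P d)
    (h0 : a + -d ∈ P) (h1 : a + -d + t ∈ P) (h2 : a + -d + -t ∈ P) : Cov P := by
  have hi := hF.ip
  refine cov_of (a := a) (b := a + d) hF hF.negr ?_ (0,-1) (1,0) (0,1) (by simp [Frame]) ?_
  · intro z hz hz'
    have h1 := far ha hz
    have h2 := far ha hz'
    simp only [ip_add, ip_smul, ip_neg, hi] at h1 h2
    omega
  · intro z hz
    simp only [Set.mem_insert_iff, Set.mem_singleton_iff] at hz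
    rcases hz with rfl | rfl | rfl | rfl | rfl
    · left; convert h0 using 1; simp
    · left; convert h1 using 1; simp; abel
    · left; convert h2 using 1; simp; abel
    · left; convert ha.1 using 1; simp
    · right; convert ha.1 using 1; simp

lemma cov1' {P : Set (ℤ × ℤ)} {t d a s e b : ℤ × ℤ} (hF : Frame t d) (ha : a ∈ Top P d)
    (hF' : Frame s e) (hb : b ∈ Top P e) (hb' : b + -e ∈ P)
    (h1 : a + t ∈ P) (h2 : a + -t ∈ P) : Cov P := by
  have hi := hF.ip
  have hi' := hF'.ip
  refine cov_of (a := a) (b := b + e) hF hF'.negr ?_ (0,0) (1,0) (0,1) (by simp [Frame]) ?_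
  · intro z hz hz'
    have h1 := far ha hz
    have h2 := far hb hz'
    simp only [ip_add, ip_smul, ip_neg, hi, hi'] at h1 h2
    omega
  · intro z hz
    simp only [Set.mem_insert_iff, Set.mem_singleton_iff] at hz
    rcases hz with rfl | rfl | rfl | rfl | rfl
    · left; convert ha.1 using 1; simp
    · left; convert h1 using 1; simp
    · left; convert h2 using 1; simp
    · right; convert hb.1 using 1; simp
    · right; convert hb' using 1; simp [-zsmul_eq_mul]; module

lemma dom {P : Set (ℤ × ℤ)} (hP : IsPolyomino P) {t d a q : ℤ × ℤ} (hF : Frame t d)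
    (ha : a ∈ Top P d) (hq : q ∈ P) (hlt : ip q d ≠ ip a d) : ∃ b ∈ Top P d, b + -d ∈ P := by
  obtain ⟨x, u, h1, h2, h3, h4, h5⟩ := exit hP {p | ip p d = ip a d} ha.1 rfl hq hlt
  simp only [Set.mem_ofPred_eq] at h2 h5
  have hx : x ∈ Top P d := ⟨h1, fun q hq => by rw [h2]; exact ha.2 q hq⟩
  have hi := hF.ip
  rcases hF.cases h3 with rfl | rfl | rfl | rfl
  · simp [ip_add, hi, h2] at h5
  · simp [ip_add, ip_neg, hi, h2] at h5
  · exact absurd h4 (no_up hF hx)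
  · exact ⟨x, hx, h4⟩

lemma cov1 {P : Set (ℤ × ℤ)} (hP : IsPolyomino P) {t d a : ℤ × ℤ} (hF : Frame t d)
    (ha : a ∈ Top P d) (h1 : a + t ∈ P) (h2 : a + -t ∈ P) : Cov P := by
  obtain ⟨b, hb⟩ := top_nonempty hP t
  have hne : ip a t ≠ ip b t := by
    have := far hb h1
    rw [ip_add, hF.ip.2.2.1] at this
    omega
  obtain ⟨b, hb, hb'⟩ := dom hP hF.symm hb ha.1 hne
  exact cov1' hF ha hF.symm hb hb' h1 h2

lemma cov3 {P : Set (ℤ × ℤ)} {t d a : ℤ × ℤ} (hF : Frame t d) (ha : a ∈ Top P d)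
    (hat : a + t ∈ P) (hall : ∀ p ∈ Top P d, p = a ∨ p = a + t) (h0 : a + -d ∈ P)
    (h : a + -d + -d ∈ P ∨ a + -d + -t ∈ P) : Cov P := by
  have hi := hF.ip
  have hd : ∀ z : ℤ × ℤ, a + z.1 • t + z.2 • d ∈ P → a + -t + z.1 • (-t) + z.2 • (-d) ∈ P →
      False := by
    intro z hz hz'
    have h1 := far ha hz
    have h2 := far ha hz'
    simp only [ip_add, ip_smul, ip_neg, hi] at h1 h2
    have h3 : z.2 = 0 := by omega
    have h4 : a + z.1 • t + z.2 • d ∈ Top P d :=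
      ⟨hz, fun q hq => by
        have := ha.2 q hq
        simp only [ip_add, ip_smul, hi, h3]; linarith⟩
    have h5 : a + -t + z.1 • (-t) + z.2 • (-d) ∈ Top P d :=
      ⟨hz', fun q hq => by
        have := ha.2 q hq
        simp only [ip_add, ip_smul, ip_neg, hi, h3]; linarith⟩
    have h6 := (hall _ h4).imp (congrArg (fun x => ip x t)) (congrArg (fun x => ip x t))
    have h7 := (hall _ h5).imp (congrArg (fun x => ip x t)) (congrArg (fun x => ip x t))
    simp only [ip_add, ip_smul, ip_neg, hi] at h6 h7
    omega
  rcases h with h | h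
  · refine cov_of hF hF.negl.negr hd (0,0) (1,0) (0,-1) (by simp [Frame]) ?_
    intro z hz
    simp only [Set.mem_insert_iff, Set.mem_singleton_iff] at hz
    rcases hz with rfl | rfl | rfl | rfl | rfl
    · left; convert ha.1 using 1; simp
    · left; convert hat using 1; simp
    · right; convert ha.1 using 1; simp
    · left; convert h0 using 1; simp
    · left; convert h using 1; simp [-zsmul_eq_mul]; module
  · refine cov_of hF hF.negl.negr hd (0,0) (0,1) (-1,0) (by simp [Frame]) ?_
    intro z hz
    simp only [Set.mem_insert_iff, Set.mem_singleton_iff] at hz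
    rcases hz with rfl | rfl | rfl | rfl | rfl
    · left; convert ha.1 using 1; simp
    · right; convert h using 1; simp; abel
    · left; convert h0 using 1; simp
    · right; convert ha.1 using 1; simp
    · right; convert hat using 1; simp [-zsmul_eq_mul]; module

lemma cov4 {P : Set (ℤ × ℤ)} (hP : IsPolyomino P) (hN : 5 ≤ P.ncard) {t d a : ℤ × ℤ}
    (hF : Frame t d) (ha : a ∈ Top P d)
    (hat : a + t ∈ P) (hall : ∀ p ∈ Top P d, p = a ∨ p = a + t) : Cov P := by
  have hi := hF.ip
  have hat' : a + t ∈ Top P d := ⟨hat, fun q hq => by simpa [ip_add, hi] using ha.2 q hq⟩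
  obtain ⟨x, u, h1, h2, h3, h4, h5, h6, h7, h8⟩ :=
    exit_card hP hN a (a + t) (a + -d) (a + t + -d) ha.1
  have up : x ∈ Top P d → False := by
    intro hx
    rcases hF.cases h3 with hu | hu | hu | hu
    · have : x + u ∈ Top P d := ⟨h4, fun q hq => by
        simpa [ip_add, hi, hu] using hx.2 q hq⟩
      exact (hall _ this).elim h5 h6
    · have : x + u ∈ Top P d := ⟨h4, fun q hq => by
        simpa [ip_add, ip_neg, hi, hu] using hx.2 q hq⟩
      exact (hall _ this).elim h5 h6
    · subst hu; exact no_up hF hx h4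
    · subst hu
      rcases hall _ hx with h | h
      · exact h7 (by rw [h])
      · exact h8 (by rw [h])
  rcases h2 with h2 | h2 | h2 | h2
  · exact (up (h2 ▸ ha)).elim
  · exact (up (h2 ▸ hat')).elim
  · subst h2
    rcases hF.cases h3 with rfl | rfl | rfl | rfl
    · exact (h8 (by abel)).elim
    · exact cov3 hF ha hat hall h1 (Or.inr h4)
    · exact (h5 (by abel)).elim
    · exact cov3 hF ha hat hall h1 (Or.inl h4)
  · subst h2
    have hall' : ∀ p ∈ Top P d, p = a + t ∨ p = a + t + -t := fun p hp => by
      rw [add_neg_cancel_right]; exact (hall p hp).symm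
    have hat2 : a + t + -t ∈ P := by rw [add_neg_cancel_right]; exact ha.1
    rcases hF.cases h3 with rfl | rfl | rfl | rfl
    · exact cov3 hF.negl hat' hat2 hall' h1 (Or.inr (by rw [neg_neg]; exact h4))
    · exact (h7 (by abel)).elim
    · exact (h6 (by abel)).elim
    · exact cov3 hF.negl hat' hat2 hall' h1 (Or.inl h4)

lemma tfree {P : Set (ℤ × ℤ)} (hP : IsPolyomino P) (hcov : ¬ Cov P) : TFree P := by
  intro c t u hF h0 h1 h2 h3 h4
  apply hcov
  obtain ⟨a, ha⟩ := top_nonempty hP (0,1)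
  have hF0 : Frame (1,0) (0,1) := by simp [Frame]
  have hi := hF0.ip
  have key : ∀ x : ℤ × ℤ, a + (x + -a).1 • ((1:ℤ),(0:ℤ)) + (x + -a).2 • ((0:ℤ),(1:ℤ)) = x := by
    intro x; ext <;> simp
  refine cov_of (a := a) (b := a + (0,1)) hF0 hF0.negr ?_ (c + -a) t u hF ?_
  · intro z hz hz'
    have h1 := far ha hz
    have h2 := far ha hz'
    simp only [ip_add, ip_smul, ip_neg, hi] at h1 h2
    omega
  · intro z hz
    left
    simp only [Set.mem_insert_iff, Set.mem_singleton_iff] at hz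
    rcases hz with rfl | rfl | rfl | rfl | rfl
    · rw [key]; exact h0
    · rw [add_right_comm c, key]; exact h1
    · rw [add_right_comm c, key]; exact h2
    · rw [add_right_comm c, key]; exact h3
    · rw [add_right_comm c, add_right_comm _ (-a), key]; exact h4

lemma top_move {P : Set (ℤ × ℤ)} {t d a : ℤ × ℤ} (hF : Frame t d) (ha : a ∈ Top P d)
    (h : a + t ∈ P) : a + t ∈ Top P d :=
  ⟨h, fun q hq => by simpa [ip_add, hF.ip] using ha.2 q hq⟩

lemma side {P : Set (ℤ × ℤ)} (hP : IsPolyomino P) (hcov : ¬ Cov P) {t d : ℤ × ℤ} (hF : Frame t d)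
    (A : Set (ℤ × ℤ)) (hA : A ⊆ Top P d) (h1 : ∀ a ∈ A, a + t ∈ Top P d → a + t ∈ A)
    (h2 : ∀ a ∈ A, a + -t ∈ Top P d → a + -t ∈ A) : Side P A t d := by
  refine ⟨fun a ha => (hA ha).1, hF, fun a ha => ⟨no_up hF (hA ha), ?_, ?_, ?_, ?_⟩⟩
  · exact fun h => h1 a ha (top_move hF (hA ha) h)
  · exact fun h => h2 a ha (top_move hF.negl (hA ha) h)
  · exact fun h => hcov (cov1 hP hF (hA ha) h.1 h.2)
  · exact fun h => hcov (cov2 hF (hA ha) h.1 h.2.1 h.2.2)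

lemma side_top {P : Set (ℤ × ℤ)} (hP : IsPolyomino P) (hcov : ¬ Cov P) {t d : ℤ × ℤ}
    (hF : Frame t d) : Side P (Top P d) t d :=
  side hP hcov hF _ le_rfl (fun _ _ h => h) (fun _ _ h => h)

lemma line {P : Set (ℤ × ℤ)} (hP : IsPolyomino P) (hN : 5 ≤ P.ncard) (hcov : ¬ Cov P)
    {t d x : ℤ × ℤ} (hF : Frame t d) (hx : x ∈ Top P d) (hx' : x ∈ Top P (-d)) : False := by
  have hi := hF.ip
  have hl : ∀ p ∈ P, ip p d = ip x d := fun p hp => by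
    have h1 := hx.2 p hp
    have h2 := hx'.2 p hp
    rw [ip_neg_right, ip_neg_right] at h2
    omega
  obtain ⟨a, ha⟩ := top_nonempty hP t
  obtain ⟨y, u, h1, h2, h3, h4, h5, h6, _⟩ := exit_card hP hN a (a + -t) a a ha.1
  have e1 := hl _ h1
  have e2 := hl _ h4
  have hy : y ∈ Top P d := ⟨h1, fun q hq => by rw [hl q hq, e1]⟩
  have h2 : y = a ∨ y = a + -t := by tauto
  rcases hF.cases h3 with rfl | rfl | rfl | rfl
  · rcases h2 with rfl | rfl
    · exact no_up hF.symm ha h4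
    · exact h5 (by abel)
  · rcases h2 with rfl | rfl
    · exact h6 rfl
    · exact hcov (cov1 hP hF hy (by rw [neg_add_cancel_right]; exact ha.1) h4)
  · rw [ip_add, hi.2.2.2] at e2; omega
  · rw [ip_add, ip_neg, hi.2.2.2] at e2; omega

lemma single {P : Set (ℤ × ℤ)} (hP : IsPolyomino P) (hN : 5 ≤ P.ncard) (hcov : ¬ Cov P)
    {t d p q : ℤ × ℤ} (hF : Frame t d) (hp : p ∈ Top P d) (hq : q ∈ Top P d) (g : ℤ)
    (hg : ∀ x ∈ Top P d, ip x t ≠ g) (h1 : ip p t < g) (h2 : g < ip q t) : False := by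
  have hi := hF.ip
  have hA : Side P {x | x ∈ Top P d ∧ ip x t < g} t d := by
    refine side hP hcov hF _ (fun x hx => hx.1) ?_ ?_
    · rintro x ⟨hx, hx'⟩ h
      refine ⟨h, ?_⟩
      have := hg _ h
      rw [ip_add, hi.2.2.1] at *
      omega
    · rintro x ⟨hx, hx'⟩ h
      refine ⟨h, ?_⟩
      have := hg _ h
      rw [ip_add, ip_neg, hi.2.2.1] at *
      omega
  have hB : Side P {x | x ∈ Top P d ∧ g < ip x t} t d := by
    refine side hP hcov hF _ (fun x hx => hx.1) ?_ ?_
    · rintro x ⟨hx, hx'⟩ h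
      refine ⟨h, ?_⟩
      have := hg _ h
      rw [ip_add, hi.2.2.1] at *
      omega
    · rintro x ⟨hx, hx'⟩ h
      refine ⟨h, ?_⟩
      have := hg _ h
      rw [ip_add, ip_neg, hi.2.2.1] at *
      omega
  refine steiner hP (tfree hP hcov) hA hB (side_top hP hcov hF.negr) ⟨p, hp, h1⟩ ⟨q, hq, h2⟩
    (top_nonempty hP _) ?_ ?_ ?_
  · rintro x ⟨_, hx⟩ ⟨_, hx'⟩
    omega
  · exact fun x hx hx' => line hP hN hcov hF hx.1 hx'
  · exact fun x hx hx' => line hP hN hcov hF hx.1 hx'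

lemma corner' {P : Set (ℤ × ℤ)} (hP : IsPolyomino P) (hN : 5 ≤ P.ncard) (hcov : ¬ Cov P)
    {t d a : ℤ × ℤ} (hF : Frame t d) (ha : a ∈ Top P d) (ha' : a ∈ Top P t) (h : a + -t ∈ P) :
    False := by
  have hi := hF.ip
  refine hcov (cov4 hP hN hF.negl ha h fun p hp => ?_)
  by_contra hne
  push Not at hne
  have e0 : ip p d = ip a d := le_antisymm (ha.2 p hp.1) (hp.2 a ha.1)
  have e1 := ha'.2 p hp.1
  have e2 : ip p t ≠ ip a t := fun e => hne.1 (hF.ext e e0)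
  have e3 : ip p t ≠ ip a t - 1 := fun e => hne.2 (hF.ext
    (by rw [ip_add, ip_neg, hi.2.2.1, e]; ring) (by rw [ip_add, ip_neg, hi.1, e0]; ring))
  have hg : ∀ x ∈ Top P d, ip x t ≠ ip a t - 2 := by
    intro x hx e
    have e0 : ip x d = ip a d := le_antisymm (ha.2 x hx.1) (hx.2 a ha.1)
    have : x = a + -t + -t := hF.ext
      (by rw [ip_add, ip_add, ip_neg, hi.2.2.1, e]; ring)
      (by rw [ip_add, ip_add, ip_neg, hi.1, e0]; ring)
    subst this
    exact hcov (cov1 hP hF (top_move hF.negl ha h)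
      (by rw [neg_add_cancel_right]; exact ha.1) hx.1)
  have := hg p hp
  exact single hP hN hcov hF hp ha _ hg (by omega) (by omega)

lemma corner {P : Set (ℤ × ℤ)} (hP : IsPolyomino P) (hN : 5 ≤ P.ncard) (hcov : ¬ Cov P)
    {t d a : ℤ × ℤ} (hF : Frame t d) (ha : a ∈ Top P d) (ha' : a ∈ Top P t) : False := by
  obtain ⟨y, u, h1, h2, h3, h4, _⟩ := exit_card hP hN a a a a ha.1
  have h2 : y = a := by tauto
  subst h2
  rcases hF.cases h3 with rfl | rfl | rfl | rfl
  · exact no_up hF.symm ha' h4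
  · exact corner' hP hN hcov hF ha ha' h4
  · exact no_up hF ha h4
  · exact corner' hP hN hcov hF.symm ha' ha h4

lemma main {P : Set (ℤ × ℤ)} (hP : IsPolyomino P) (hN : 5 ≤ P.ncard) : Cov P := by
  by_contra hcov
  have hF : Frame (1,0) (0,1) := by simp [Frame]
  exact steiner hP (tfree hP hcov) (side_top hP hcov hF) (side_top hP hcov hF.symm)
    (side_top hP hcov hF.negl.symm) (top_nonempty hP _) (top_nonempty hP _) (top_nonempty hP _)
    (fun x h h' => corner hP hN hcov hF h h') (fun x h h' => corner hP hN hcov hF.negl h h')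
    (fun x h h' => line hP hN hcov hF.symm h h')

end TP

/-- The T-pentomino is always-coverable. -/
theorem pentominoT_alwaysCoverable :
    AlwaysCoverable ({(0,0), (1,0), (2,0), (1,1), (1,2)} : Set (ℤ × ℤ)) := by
  exact ⟨5, fun P hP hN => TP.main hP hN⟩
end
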